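/- arXiv:2204.07524 — 2 statements merged into one kernel-verified Lean document; each statement's English description precedes it below -/
import Mathlib

section
/- Consider a pairwise CRF and a fixed configuration y* : V → 𝒴. The derivative of the log-likelihood t ↦ log p_{θ(t)}(y*) vanishes at the current parameters for every single table entry (i.e., for every s₀ ∈ V and ŷ ∈ 𝒴 when perturbing θ_{s₀}(ŷ), and for every (s₀,t₀) ∈ E and ŷ, ŷ' ∈ 𝒴 when perturbing θ_{s₀t₀}(ŷ, ŷ')) if and only if the moment-matching conditions hold: p_θ(Y_s = a) = 𝕀[y*(s) = a] for all s ∈ V and a ∈ 𝒴, and p_θ(Y_s = a, Y_t = b) = 𝕀[(y*(s), y*(t)) = (a, b)] for all (s,t) ∈ E and a, b ∈ 𝒴. -/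
/-- Potential of a pairwise CRF. -/
noncomputable def crfPsi {V 𝒴 : Type*} [Fintype V] (E : Finset (V × V))
    (θn : V → 𝒴 → ℝ) (θe : V × V → 𝒴 → 𝒴 → ℝ) (y : V → 𝒴) : ℝ :=
  Real.exp ((∑ s, θn s (y s)) + ∑ e ∈ E, θe e (y e.1) (y e.2))

/-- Partition function of a pairwise CRF. -/
noncomputable def crfZ {V 𝒴 : Type*} [Fintype V] [DecidableEq V] [Fintype 𝒴]
    (E : Finset (V × V)) (θn : V → 𝒴 → ℝ) (θe : V × V → 𝒴 → 𝒴 → ℝ) : ℝ :=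
  ∑ y : V → 𝒴, crfPsi E θn θe y

/-- Distribution of a pairwise CRF: `p_θ(y) = ψ_θ(y)/Z_θ`. -/
noncomputable def crfP {V 𝒴 : Type*} [Fintype V] [DecidableEq V] [Fintype 𝒴]
    (E : Finset (V × V)) (θn : V → 𝒴 → ℝ) (θe : V × V → 𝒴 → 𝒴 → ℝ) (y : V → 𝒴) : ℝ :=
  crfPsi E θn θe y / crfZ E θn θe

theorem crfPsi_pos {V 𝒴 : Type*} [Fintype V] (E : Finset (V × V))
    (θn : V → 𝒴 → ℝ) (θe : V × V → 𝒴 → 𝒴 → ℝ) (y : V → 𝒴) : 0 < crfPsi E θn θe y :=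
  Real.exp_pos _

theorem crfZ_pos {V 𝒴 : Type*} [Fintype V] [DecidableEq V] [Fintype 𝒴] [Nonempty 𝒴]
    (E : Finset (V × V)) (θn : V → 𝒴 → ℝ) (θe : V × V → 𝒴 → 𝒴 → ℝ) : 0 < crfZ E θn θe :=
  Finset.sum_pos (fun y _ => crfPsi_pos E θn θe y) Finset.univ_nonempty

/-- If a one-parameter family of CRFs tilts the log-potential linearly along the indicator of an
event, then the log-likelihood has derivative equal to the indicator minus the probability of the
event. -/
theorem hasDerivAt_log_crfP {V 𝒴 : Type*} [Fintype V] [DecidableEq V]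
    [Fintype 𝒴] [Nonempty 𝒴] (E : Finset (V × V))
    (θn : V → 𝒴 → ℝ) (θe : V × V → 𝒴 → 𝒴 → ℝ)
    (ηn : ℝ → V → 𝒴 → ℝ) (ηe : ℝ → V × V → 𝒴 → 𝒴 → ℝ)
    (p : (V → 𝒴) → Prop) [DecidablePred p] (t₀ : ℝ)
    (h : ∀ t y, crfPsi E (ηn t) (ηe t) y
      = crfPsi E θn θe y * Real.exp ((t - t₀) * if p y then 1 else 0)) (ystar : V → 𝒴) :
    HasDerivAt (fun t => Real.log (crfP E (ηn t) (ηe t) ystar))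
      ((if p ystar then 1 else 0) - ∑ y ∈ Finset.univ.filter p, crfP E θn θe y) t₀ := by
  have hpsi : ∀ y, HasDerivAt (fun t => crfPsi E (ηn t) (ηe t) y)
      (crfPsi E θn θe y * if p y then 1 else 0) t₀ := by
    intro y
    simp only [h]
    have h1 := ((((hasDerivAt_id t₀).sub_const t₀).mul_const
      (if p y then (1 : ℝ) else 0)).exp).const_mul (crfPsi E θn θe y)
    simpa using h1
  have hpsi₀ : ∀ y, crfPsi E (ηn t₀) (ηe t₀) y = crfPsi E θn θe y := by
    intro y
    simp [h]
  have hZ₀ : crfZ E (ηn t₀) (ηe t₀) = crfZ E θn θe := by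
    simp only [crfZ, hpsi₀]
  have hZ : HasDerivAt (fun t => crfZ E (ηn t) (ηe t))
      (∑ y, crfPsi E θn θe y * if p y then 1 else 0) t₀ := by
    simp only [crfZ]
    exact HasDerivAt.fun_sum fun y _ => hpsi y
  have hlog := ((hpsi ystar).log (crfPsi_pos E _ _ ystar).ne').sub
    (hZ.log (crfZ_pos E _ _).ne')
  have hfun : (fun t => Real.log (crfP E (ηn t) (ηe t) ystar))
      = (fun t => Real.log (crfPsi E (ηn t) (ηe t) ystar))
        - fun t => Real.log (crfZ E (ηn t) (ηe t)) := by
    funext t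
    exact Real.log_div (crfPsi_pos E _ _ ystar).ne' (crfZ_pos E _ _).ne'
  rw [hfun]
  refine hlog.congr_deriv ?_
  rw [hpsi₀, hZ₀, mul_div_cancel_left₀ _ (crfPsi_pos E θn θe ystar).ne']
  simp [crfP, Finset.sum_div, Finset.sum_filter, ite_div]

/-- The derivative in the tilting direction vanishes iff the probability of the event equals its
indicator at the observed configuration. -/
theorem hasDerivAt_log_crfP_zero_iff {V 𝒴 : Type*} [Fintype V] [DecidableEq V]
    [Fintype 𝒴] [Nonempty 𝒴] (E : Finset (V × V))
    (θn : V → 𝒴 → ℝ) (θe : V × V → 𝒴 → 𝒴 → ℝ)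
    (ηn : ℝ → V → 𝒴 → ℝ) (ηe : ℝ → V × V → 𝒴 → 𝒴 → ℝ)
    (p : (V → 𝒴) → Prop) [DecidablePred p] (t₀ : ℝ)
    (h : ∀ t y, crfPsi E (ηn t) (ηe t) y
      = crfPsi E θn θe y * Real.exp ((t - t₀) * if p y then 1 else 0)) (ystar : V → 𝒴) :
    HasDerivAt (fun t => Real.log (crfP E (ηn t) (ηe t) ystar)) 0 t₀ ↔
      ∑ y ∈ Finset.univ.filter p, crfP E θn θe y = if p ystar then 1 else 0 := by
  have hd := hasDerivAt_log_crfP E θn θe ηn ηe p t₀ h ystar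
  constructor
  · intro h0
    exact (sub_eq_zero.mp (hd.unique h0)).symm
  · intro heq
    rwa [heq, sub_self] at hd

theorem crfPsi_update_node {V 𝒴 : Type*} [Fintype V] [DecidableEq V] [DecidableEq 𝒴]
    (E : Finset (V × V)) (θn : V → 𝒴 → ℝ) (θe : V × V → 𝒴 → 𝒴 → ℝ)
    (s : V) (a : 𝒴) (t : ℝ) (y : V → 𝒴) :
    crfPsi E (Function.update θn s (Function.update (θn s) a t)) θe y
      = crfPsi E θn θe y * Real.exp ((t - θn s a) * if y s = a then 1 else 0) := by
  have key : ∀ v, Function.update θn s (Function.update (θn s) a t) v (y v)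
      = θn v (y v) + if v = s then (t - θn s a) * (if y s = a then 1 else 0) else 0 := by
    intro v
    by_cases hv : v = s
    · subst hv
      by_cases ha : y v = a
      · simp [ha]
      · simp [ha]
    · simp [hv]
  rw [crfPsi, crfPsi, ← Real.exp_add]
  simp only [key, Finset.sum_add_distrib, Finset.sum_ite_eq', Finset.mem_univ, if_true]
  congr 1
  ring

theorem crfPsi_update_edge {V 𝒴 : Type*} [Fintype V] [DecidableEq V] [DecidableEq 𝒴]
    (E : Finset (V × V)) (θn : V → 𝒴 → ℝ) (θe : V × V → 𝒴 → 𝒴 → ℝ)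
    {e : V × V} (he : e ∈ E) (a b : 𝒴) (t : ℝ) (y : V → 𝒴) :
    crfPsi E θn (Function.update θe e
        (fun a' b' => if a' = a ∧ b' = b then t else θe e a' b')) y
      = crfPsi E θn θe y
        * Real.exp ((t - θe e a b) * if y e.1 = a ∧ y e.2 = b then 1 else 0) := by
  have key : ∀ d : V × V, Function.update θe e
        (fun a' b' => if a' = a ∧ b' = b then t else θe e a' b') d (y d.1) (y d.2)
      = θe d (y d.1) (y d.2)
        + if d = e then (t - θe e a b) * (if y e.1 = a ∧ y e.2 = b then 1 else 0) else 0 := by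
    intro d
    by_cases hd : d = e
    · subst hd
      by_cases hab : y d.1 = a ∧ y d.2 = b
      · simp [hab.1, hab.2]
      · simp [hab]
    · simp [hd]
  rw [crfPsi, crfPsi, ← Real.exp_add]
  simp only [key, Finset.sum_add_distrib, Finset.sum_ite_eq', he, if_true]
  congr 1
  ring

/-- Eq. (4) of the paper: the derivative of the log-likelihood with respect to every
single node/edge table entry vanishes at the current parameters if and only if the
moment-matching conditions hold: the node marginals of `p_θ` equal `𝕀[y*(s) = a]`
and the edge marginals equal `𝕀[(y*(s), y*(t)) = (a, b)]`. -/
theorem crf_deriv_zero_iff_moment_matching {V 𝒴 : Type*} [Fintype V] [DecidableEq V]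
    [Fintype 𝒴] [DecidableEq 𝒴] [Nonempty 𝒴] (E : Finset (V × V))
    (θn : V → 𝒴 → ℝ) (θe : V × V → 𝒴 → 𝒴 → ℝ) (ystar : V → 𝒴) :
    ((∀ (s₀ : V) (yhat : 𝒴),
        HasDerivAt
          (fun t => Real.log
            (crfP E (Function.update θn s₀ (Function.update (θn s₀) yhat t)) θe ystar))
          0 (θn s₀ yhat))
      ∧ (∀ e ∈ E, ∀ (yhat yhat' : 𝒴),
          HasDerivAt
            (fun t => Real.log
              (crfP E θn
                (Function.update θe e
                  (fun a b => if a = yhat ∧ b = yhat' then t else θe e a b)) ystar))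
            0 (θe e yhat yhat')))
    ↔ ((∀ (s : V) (a : 𝒴),
          (∑ y ∈ Finset.univ.filter (fun y : V → 𝒴 => y s = a), crfP E θn θe y)
            = if ystar s = a then 1 else 0)
      ∧ (∀ e ∈ E, ∀ (a b : 𝒴),
          (∑ y ∈ Finset.univ.filter (fun y : V → 𝒴 => y e.1 = a ∧ y e.2 = b),
              crfP E θn θe y)
            = if (ystar e.1, ystar e.2) = (a, b) then 1 else 0)) := by
  refine and_congr (forall₂_congr fun s a => ?_)
    (forall₂_congr fun e he => forall₂_congr fun a b => ?_)
  · exact hasDerivAt_log_crfP_zero_iff E θn θe _ (fun _ => θe) (fun y => y s = a) _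
      (crfPsi_update_node E θn θe s a) ystar
  · simp only [Prod.mk.injEq]
    exact hasDerivAt_log_crfP_zero_iff E θn θe (fun _ => θn) _
      (fun y => y e.1 = a ∧ y e.2 = b) _ (crfPsi_update_edge E θn θe he a b) ystar
end

section
/- Let 𝒴 be a finite nonempty type, V a finite type, and A ⊆ V × V a symmetric adjacency relation. Suppose for each s ∈ V we are given a strictly positive τ_s : 𝒴 → ℝ, and for each ordered pair (s,t) ∈ A a strictly positive τ_{st} : 𝒴 × 𝒴 → ℝ satisfying ∑_{b∈𝒴} τ_{st}(a, b) = τ_s(a) for all a and ∑_{a∈𝒴} τ_{st}(a, b) = τ_t(b) for all b. Define θ_s(a) = log τ_s(a) and θ_{st}(a, b) = log(τ_{st}(a, b)/(τ_s(a) τ_t(b))). For a family of messages m, one per ordered pair (t,s) ∈ A, with each m_{t→s} : 𝒴 → ℝ, define the sum-product update BP(m)_{t→s}(a) = ∑_{b∈𝒴} exp(θ_t(b) + θ_{st}(a, b)) · ∏_{s' : (s',t)∈A, s'≠s} m_{s'→t}(b). Then the constant family m_{t→s}(a) = 1 for all (t,s) ∈ A and a ∈ 𝒴 satisfies BP(m)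 = m. -/
/-- Proposition 1 of the paper: if the pairwise CRF potentials are parameterized by
locally consistent, strictly positive pseudomarginals via `θ_s = log τ_s` and
`θ_{st} = log (τ_{st}/(τ_s τ_t))`, then the all-ones message family is a fixed point
of the sum-product loopy belief propagation update
`BP(m)_{t→s}(a) = ∑_b exp (θ_t(b) + θ_{st}(a,b)) ∏_{s' : (s',t)∈A, s'≠s} m_{s'→t}(b)`. -/
theorem all_ones_messages_bp_fixed_point {V 𝒴 : Type*} [Fintype V] [DecidableEq V]
    [Fintype 𝒴] [Nonempty 𝒴]
    (A : Finset (V × V)) (hA : ∀ s t : V, (s, t) ∈ A → (t, s) ∈ A)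
    (τ : V → 𝒴 → ℝ) (τe : V × V → 𝒴 → 𝒴 → ℝ)
    (hτ : ∀ (s : V) (a : 𝒴), 0 < τ s a)
    (hτe : ∀ p ∈ A, ∀ (a b : 𝒴), 0 < τe p a b)
    (hrow : ∀ s t : V, (s, t) ∈ A → ∀ a, ∑ b, τe (s, t) a b = τ s a)
    (hcol : ∀ s t : V, (s, t) ∈ A → ∀ b, ∑ a, τe (s, t) a b = τ t b)
    (θn : V → 𝒴 → ℝ) (θe : V × V → 𝒴 → 𝒴 → ℝ)
    (hθn : ∀ (s : V) (a : 𝒴), θn s a = Real.log (τ s a))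
    (hθe : ∀ s t : V, (s, t) ∈ A → ∀ a b,
      θe (s, t) a b = Real.log (τe (s, t) a b / (τ s a * τ t b)))
    (m : V × V → 𝒴 → ℝ) (hm : ∀ p a, m p a = 1) :
    ∀ t s : V, (t, s) ∈ A → ∀ a : 𝒴,
      (∑ b, Real.exp (θn t b + θe (s, t) a b)
          * ∏ s' ∈ Finset.univ.filter (fun s' : V => (s', t) ∈ A ∧ s' ≠ s), m (s', t) b)
        = m (t, s) a := by
  intro t s hts a
  have hst := hA t s hts
  have summand_eq (b : 𝒴) :
      Real.exp (θn t b + θe (s, t) a b) = τe (s, t) a b / τ s a := by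
    have hs := hτ s a
    have ht := hτ t b
    have he := hτe (s, t) hst a b
    rw [hθn, hθe s t hst, Real.exp_add, Real.exp_log ht, Real.exp_log (by positivity)]
    field_simp
  simp only [hm, Finset.prod_const_one, mul_one, summand_eq]
  rw [← Finset.sum_div, hrow s t hst, div_self (hτ s a).ne']
end
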